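/- arXiv:2009.03020 — 2 statements merged into one kernel-verified Lean document; each statement's English description precedes it below -/
import Mathlib

section
/- Let A and B be real symmetric m×m matrices and let μ ∈ ℝ. Then ‖ABA − μI‖_F² + (1/2)‖A²B − BA²‖_F² = ‖A²B − μI‖_F², where I is the m×m identity matrix. -/
open Matrix

/-- Frobenius norm of a real square matrix: `‖A‖_F = √(trace(Aᵀ A))`. -/
noncomputable def frobNorm {m : ℕ} (A : Matrix (Fin m) (Fin m) ℝ) : ℝ :=
  Real.sqrt ((Aᵀ * A).trace)

theorem frobNorm_sq {m : ℕ} (A : Matrix (Fin m) (Fin m) ℝ) :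
    frobNorm A ^ 2 = (Aᵀ * A).trace :=
  Real.sq_sqrt (by simpa using (Matrix.posSemidef_conjTranspose_mul_self A).trace_nonneg)

/-- For real symmetric `m × m` matrices `A`, `B` and `μ ∈ ℝ`:
`‖ABA − μI‖_F² + (1/2)‖A²B − BA²‖_F² = ‖A²B − μI‖_F²`. -/
theorem frob_sq_identity {m : ℕ} (A B : Matrix (Fin m) (Fin m) ℝ) (μ : ℝ)
    (hA : Aᵀ = A) (hB : Bᵀ = B) :
    frobNorm (A * B * A - μ • (1 : Matrix (Fin m) (Fin m) ℝ)) ^ 2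
      + (1 / 2) * frobNorm (A * A * B - B * (A * A)) ^ 2
      = frobNorm (A * A * B - μ • (1 : Matrix (Fin m) (Fin m) ℝ)) ^ 2 := by
  have hABA : (A * (B * A)).trace = (A * (A * B)).trace := by
    rw [← mul_assoc, trace_mul_comm]
  have hBAA : (B * (A * A)).trace = (A * (A * B)).trace := by
    rw [trace_mul_comm, mul_assoc]
  have hABAABA : (A * (B * (A * (A * (B * A))))).trace
      = (B * (A * (A * (B * (A * A))))).trace := by
    rw [trace_mul_comm]
    simp only [mul_assoc]
  have hAABAAB : (A * (A * (B * (A * (A * B))))).trace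
      = (B * (A * (A * (B * (A * A))))).trace := by
    rw [trace_mul_comm B]
    simp only [mul_assoc]
  have hAABBAA : (A * (A * (B * (B * (A * A))))).trace
      = (B * (A * (A * (A * (A * B))))).trace := by
    rw [← mul_assoc A A, ← mul_assoc (A * A) B, trace_mul_comm]
    simp only [mul_assoc]
  simp only [frobNorm_sq, transpose_sub, transpose_mul, transpose_smul, transpose_one, hA, hB,
    sub_mul, mul_sub, smul_mul_assoc, mul_smul_comm, one_mul, mul_one, trace_sub, trace_smul,
    smul_eq_mul, mul_assoc, hABA, hBAA, hABAABA, hAABAAB, hAABBAA]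
  ring
end

section
/- Let U be a real symmetric m×m matrix and B a real symmetric positive definite m×m matrix. Then ‖UB‖_F ≤ (1/√2) ‖UB + BU‖_F. -/
open Matrix

theorem trace_transpose_mul_self_nonneg {m n : Type*} [Fintype m] [Fintype n]
    (A : Matrix m n ℝ) : 0 ≤ (Aᵀ * A).trace := by
  simpa only [conjTranspose_eq_transpose_of_trivial] using
    (posSemidef_conjTranspose_mul_self A).trace_nonneg

open scoped MatrixOrder in
theorem trace_mul_mul_mul_nonneg {n : Type*} [Fintype n]
    {U B : Matrix n n ℝ} (hU : Uᵀ = U) (hB : B.PosSemidef) :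
    0 ≤ (U * B * (U * B)).trace := by
  classical
  obtain ⟨C, rfl⟩ := CStarAlgebra.nonneg_iff_eq_star_mul_self.mp hB.nonneg
  have h : (U * (star C * C) * (U * (star C * C))).trace =
      ((C * U * Cᵀ)ᵀ * (C * U * Cᵀ)).trace := by
    simp only [star_eq_conjTranspose, conjTranspose_eq_transpose_of_trivial, transpose_mul,
      transpose_transpose, hU,
      ← Matrix.mul_assoc]
    rw [trace_mul_comm]
    simp only [Matrix.mul_assoc]
  rw [h]
  exact trace_transpose_mul_self_nonneg _

theorem trace_transpose_mul_self_add {n : Type*} [Fintype n]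
    {U B : Matrix n n ℝ} (hU : Uᵀ = U) (hB : Bᵀ = B) :
    ((U * B + B * U)ᵀ * (U * B + B * U)).trace =
      2 * ((U * B)ᵀ * (U * B)).trace + 2 * (U * B * (U * B)).trace := by
  have h₁ : (U * B * (B * U)).trace = (B * U * (U * B)).trace := trace_mul_comm _ _
  have h₂ : (B * U * (B * U)).trace = (U * B * (U * B)).trace := by
    rw [Matrix.mul_assoc, trace_mul_comm]
    simp only [Matrix.mul_assoc]
  simp only [transpose_add, transpose_mul, hU, hB, Matrix.add_mul, Matrix.mul_add, trace_add,
    h₁, h₂]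
  ring

/-- For `U` real symmetric and `B` real symmetric positive definite:
`‖UB‖_F ≤ (1/√2) ‖UB + BU‖_F`. -/
theorem frob_UB_le_sym {m : ℕ} (U B : Matrix (Fin m) (Fin m) ℝ)
    (hU : Uᵀ = U) (hB : B.PosDef) :
    frobNorm (U * B) ≤ (1 / Real.sqrt 2) * frobNorm (U * B + B * U) := by
  have hBt : Bᵀ = B := by
    simpa only [conjTranspose_eq_transpose_of_trivial] using hB.isHermitian.eq
  have hnonneg := trace_mul_mul_mul_nonneg hU hB.posSemidef
  rw [one_div_mul_eq_div, le_div_iff₀ (by positivity), frobNorm, frobNorm,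
    ← Real.sqrt_mul (trace_transpose_mul_self_nonneg _)]
  apply Real.sqrt_le_sqrt
  rw [trace_transpose_mul_self_add hU hBt]
  linarith
end
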